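/- arXiv:1401.4774 — 2 statements merged into one kernel-verified Lean document; each statement's English description precedes it below -/
import Mathlib

section
/- Let f : E → ℝ be a continuous convex function on a finite-dimensional real inner product space E, and let r ∈ ℝ be a value that is not the minimum value of f. Then the boundary of the sublevel set [f ≤ r] := {x : f(x) ≤ r} equals the level set [f = r] := {x : f(x) = r}; moreover, F is a proper face of [f ≤ r] if and only if F coincides with M ∩ [f = r] for some face M of f. -/
noncomputable section

open Set

/-- A face of a convex set `Q`: a convex subset `F ⊆ Q` such that every closed segment in `Q`
whose relative interior meets `F` lies entirely in `F`. -/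
def IsFace {V : Type*} [AddCommGroup V] [Module ℝ V] (Q F : Set V) : Prop :=
  F ⊆ Q ∧ Convex ℝ F ∧
    ∀ ⦃x⦄, x ∈ Q → ∀ ⦃y⦄, y ∈ Q → ∀ ⦃t : ℝ⦄, 0 < t → t < 1 →
      (1 - t) • x + t • y ∈ F → x ∈ F ∧ y ∈ F

/-- `F` is a face of the real-valued function `f` when `gph f|_F` is a face of `epi f`. -/
def IsRealFnFace {V : Type*} [AddCommGroup V] [Module ℝ V] (f : V → ℝ) (F : Set V) : Prop :=
  IsFace {p : V × ℝ | f p.1 ≤ p.2} ((F ×ˢ (univ : Set ℝ)) ∩ {p : V × ℝ | f p.1 = p.2})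

/-- The points `p` of `Q` such that some segment of `Q` starting at `p` has a point of `F` in its
relative interior; for convex `F ⊆ Q` this is the smallest face of `Q` containing `F`. -/
def faceHull {V : Type*} [AddCommGroup V] [Module ℝ V] (Q F : Set V) : Set V :=
  {p | p ∈ Q ∧ ∃ z ∈ F, ∃ ε : ℝ, 0 < ε ∧ z + ε • (z - p) ∈ Q}

theorem faceHull_left_mem {V : Type*} [AddCommGroup V] [Module ℝ V] {Q F : Set V}
    (hQ : Convex ℝ Q) {x y : V} (hx : x ∈ Q) (hy : y ∈ Q) {t : ℝ} (ht0 : 0 < t) (ht1 : t < 1)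
    (h : (1 - t) • x + t • y ∈ faceHull Q F) : x ∈ faceHull Q F := by
  obtain ⟨-, z, hz, ε, hε, hq⟩ := h
  have hpos : 0 < 1 + ε * t := by positivity
  have ht : 0 < 1 - t := sub_pos.2 ht1
  refine ⟨hx, z, hz, ε * (1 - t) / (1 + ε * t), by positivity, ?_⟩
  have hcomb := hQ hq hy (a := 1 / (1 + ε * t)) (b := ε * t / (1 + ε * t))
    (by positivity) (by positivity) (by field_simp)
  convert hcomb using 1
  match_scalars <;> field_simp <;> ring

theorem convex_faceHull {V : Type*} [AddCommGroup V] [Module ℝ V] {Q F : Set V}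
    (hQ : Convex ℝ Q) (hF : Convex ℝ F) (hFQ : F ⊆ Q) : Convex ℝ (faceHull Q F) := by
  have shrink : ∀ {p z : V} {δ ε : ℝ}, z ∈ F → 0 < δ → δ ≤ ε → z + ε • (z - p) ∈ Q →
      z + δ • (z - p) ∈ Q := by
    intro p z δ ε hz hδ hle hq
    have hε : 0 < ε := hδ.trans_le hle
    have hcomb := hQ (hFQ hz) hq (a := 1 - δ / ε) (b := δ / ε)
      (sub_nonneg.2 ((div_le_one hε).2 hle)) (by positivity) (by ring)
    convert hcomb using 1
    match_scalars <;> field_simp <;> ring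
  rintro p ⟨hp, z, hz, ε, hε, hq⟩ p' ⟨hp', z', hz', ε', hε', hq'⟩ a b ha hb hab
  have hmin : 0 < min ε ε' := lt_min hε hε'
  refine ⟨hQ hp hp' ha hb hab, a • z + b • z', hF hz hz' ha hb hab, min ε ε', hmin, ?_⟩
  convert hQ (shrink hz hmin (min_le_left _ _) hq) (shrink hz' hmin (min_le_right _ _) hq')
    ha hb hab using 1
  module

theorem isFace_faceHull {V : Type*} [AddCommGroup V] [Module ℝ V] {Q F : Set V}
    (hQ : Convex ℝ Q) (hF : Convex ℝ F) (hFQ : F ⊆ Q) : IsFace Q (faceHull Q F) := by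
  refine ⟨fun p hp => hp.1, convex_faceHull hQ hF hFQ, fun x hx y hy t ht0 ht1 h => ?_⟩
  refine ⟨faceHull_left_mem hQ hx hy ht0 ht1 h,
    faceHull_left_mem hQ hy hx (t := 1 - t) (by linarith) (by linarith) ?_⟩
  rwa [sub_sub_cancel, add_comm]

/-- From an interior point `z` of `Q` one can move a little further away from any point `x`. -/
theorem exists_pos_add_smul_sub_mem_of_mem_interior {E : Type*} [NormedAddCommGroup E]
    [NormedSpace ℝ E] {Q : Set E} {z : E} (hz : z ∈ interior Q) (x : E) :
    ∃ ε : ℝ, 0 < ε ∧ z + ε • (z - x) ∈ Q := by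
  have hcont : Continuous fun ε : ℝ => z + ε • (z - x) := by fun_prop
  have hev : ∀ᶠ ε : ℝ in nhds 0, z + ε • (z - x) ∈ Q :=
    hcont.continuousAt.eventually_mem (by simpa using mem_interior_iff_mem_nhds.1 hz)
  obtain ⟨ε, hε, hmem⟩ :=
    ((hev.filter_mono nhdsWithin_le_nhds).and (self_mem_nhdsWithin (s := Ioi 0))).exists
  exact ⟨ε, hmem, hε⟩

/-- A face containing an interior point is the whole set. -/
theorem IsFace.eq_of_mem_interior {E : Type*} [NormedAddCommGroup E] [NormedSpace ℝ E]
    {Q F : Set E} (hF : IsFace Q F) {z : E} (hz : z ∈ F) (hzQ : z ∈ interior Q) : F = Q := by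
  refine hF.1.antisymm fun x hx => ?_
  obtain ⟨ε, hε, hq⟩ := exists_pos_add_smul_sub_mem_of_mem_interior hzQ x
  refine (hF.2.2 hx hq (t := 1 / (1 + ε)) (by positivity)
    ((div_lt_one (by positivity)).2 (by linarith)) ?_).1
  convert hz using 1
  match_scalars <;> field_simp <;> ring

theorem ConvexOn.one_add_mul_le {V : Type*} [AddCommGroup V] [Module ℝ V] {f : V → ℝ}
    (hconv : ConvexOn ℝ univ f) (x z : V) {ε : ℝ} (hε : 0 < ε) :
    (1 + ε) * f z ≤ ε * f x + f (z + ε • (z - x)) := by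
  have hsum : ε / (1 + ε) + 1 / (1 + ε) = 1 := by field_simp; ring
  have h := hconv.2 (mem_univ x) (mem_univ (z + ε • (z - x))) (by positivity) (by positivity)
    hsum
  have hz : (ε / (1 + ε)) • x + (1 / (1 + ε)) • (z + ε • (z - x)) = z := by
    match_scalars <;> field_simp <;> ring
  rw [hz, smul_eq_mul, smul_eq_mul] at h
  rw [mul_comm, ← le_div_iff₀ (by positivity)]
  exact h.trans_eq (by ring)

theorem ConvexOn.interior_sublevel {E : Type*} [NormedAddCommGroup E] [NormedSpace ℝ E]
    {f : E → ℝ} (hcont : Continuous f) (hconv : ConvexOn ℝ univ f) {r : ℝ} {x₀ : E}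
    (hx₀ : f x₀ < r) : interior {x | f x ≤ r} = {x | f x < r} := by
  refine Subset.antisymm (fun z hz => ?_)
    (interior_maximal (fun x (hx : f x < r) => hx.le) (isOpen_lt hcont continuous_const))
  obtain ⟨ε, hε, hq⟩ := exists_pos_add_smul_sub_mem_of_mem_interior hz x₀
  replace hq : f (z + ε • (z - x₀)) ≤ r := hq
  have h := hconv.one_add_mul_le x₀ z hε
  have hlt : ε * f x₀ < ε * r := by gcongr
  exact lt_of_mul_lt_mul_left (a := 1 + ε) (by linarith) (by positivity)

theorem ConvexOn.frontier_sublevel {E : Type*} [NormedAddCommGroup E] [NormedSpace ℝ E]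
    {f : E → ℝ} (hcont : Continuous f) (hconv : ConvexOn ℝ univ f) {r : ℝ} {x₀ : E}
    (hx₀ : f x₀ < r) : frontier {x | f x ≤ r} = {x | f x = r} := by
  rw [(isClosed_le hcont continuous_const).frontier_eq, hconv.interior_sublevel hcont hx₀]
  ext x
  simp [le_antisymm_iff]

/-- A level set cuts a face of `f` in a face of the sublevel set. -/
theorem IsRealFnFace.isFace_inter_level {V : Type*} [AddCommGroup V] [Module ℝ V] {f : V → ℝ}
    {M : Set V} (hM : IsRealFnFace f M) (r : ℝ) :
    IsFace {x | f x ≤ r} (M ∩ {x | f x = r}) := by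
  obtain ⟨-, hMconv, hMface⟩ := hM
  refine ⟨fun x hx => hx.2.le, fun x hx y hy a b ha hb hab => ?_,
    fun x hx y hy t ht0 ht1 h => ?_⟩
  · have h := hMconv (x := (x, r)) ⟨⟨hx.1, mem_univ _⟩, hx.2⟩ (y := (y, r))
      ⟨⟨hy.1, mem_univ _⟩, hy.2⟩ ha hb hab
    refine ⟨h.1.1, h.2.trans ?_⟩
    simp [← add_mul, hab]
  · have hr : (1 - t) * r + t * r = r := by ring
    have h' := hMface (x := (x, r)) hx (y := (y, r)) hy ht0 ht1
      ⟨⟨h.1, mem_univ _⟩, by simpa [hr] using h.2⟩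
    exact ⟨⟨h'.1.1.1, h'.1.2⟩, ⟨h'.2.1.1, h'.2.2⟩⟩

/-- A face of a sublevel set contained in the level set is cut out by a face of `f`. -/
theorem IsFace.exists_isRealFnFace_of_subset_level {V : Type*} [AddCommGroup V] [Module ℝ V]
    {f : V → ℝ} (hconv : ConvexOn ℝ univ f) {r : ℝ} {F : Set V}
    (hF : IsFace {x | f x ≤ r} F) (hFr : ∀ x ∈ F, f x = r) :
    ∃ M : Set V, IsRealFnFace f M ∧ F = M ∩ {x | f x = r} := by
  set Q : Set (V × ℝ) := {p | f p.1 ≤ p.2} with hQdef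
  have hQ : Convex ℝ Q := by simpa [hQdef] using hconv.convex_epigraph
  set G := faceHull Q (F ×ˢ {r})
  have hG : IsFace Q G := isFace_faceHull hQ (hF.2.1.prod (convex_singleton r)) (by
    rintro ⟨x, s⟩ ⟨hx, rfl : s = r⟩
    exact (hFr x hx).le)
  have hgraph : ∀ p ∈ G, f p.1 = p.2 := by
    rintro ⟨x, s⟩ ⟨hp, ⟨z, s'⟩, ⟨hz, rfl : s' = r⟩, ε, hε, hq⟩
    replace hp : f x ≤ s := hp
    replace hq : f (z + ε • (z - x)) ≤ s' + ε * (s' - s) := hq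
    refine le_antisymm hp ?_
    have h := hconv.one_add_mul_le x z hε
    rw [hFr z hz] at h
    exact le_of_mul_le_mul_left (by linarith) hε
  refine ⟨{x | (x, f x) ∈ G}, ?_, ?_⟩
  · have hMG : ({x | (x, f x) ∈ G} ×ˢ (univ : Set ℝ)) ∩ {p : V × ℝ | f p.1 = p.2} = G := by
      ext ⟨x, s⟩
      constructor
      · rintro ⟨⟨hx, -⟩, rfl : f x = s⟩
        exact hx
      · intro h
        obtain rfl : f x = s := hgraph _ h
        exact ⟨⟨h, mem_univ _⟩, rfl⟩
    unfold IsRealFnFace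
    rwa [hMG]
  · ext x
    constructor
    · intro hx
      have hxr := hFr x hx
      refine ⟨⟨(le_rfl : f x ≤ f x), (x, r), ⟨hx, rfl⟩, 1, one_pos, ?_⟩, hxr⟩
      simp [hQdef, hxr]
    · rintro ⟨⟨-, ⟨z, s'⟩, ⟨hz, rfl : s' = r⟩, ε, hε, hq⟩, hxr : f x = s'⟩
      have hy : f (z + ε • (z - x)) ≤ s' := by simpa [hQdef, hxr] using hq
      refine (hF.2.2 hxr.le hy (t := 1 / (1 + ε)) (by positivity)
        ((div_lt_one (by positivity)).2 (by linarith)) ?_).1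
      convert hz using 1
      match_scalars <;> field_simp <;> ring

/-- **Faces of sublevel sets.**  For a continuous convex `f : E → ℝ` and `r` not a minimal value
of `f`, `bd [f ≤ r] = [f = r]`, and `F` is a proper face of `[f ≤ r]` iff `F = M ∩ [f = r]`
for some face `M` of `f`. -/
theorem stmt4 {E : Type*} [NormedAddCommGroup E] [InnerProductSpace ℝ E]
    [FiniteDimensional ℝ E] (f : E → ℝ) (hcont : Continuous f)
    (hconv : ConvexOn ℝ univ f) (r : ℝ) (hr : ¬ ∀ x, r ≤ f x) :
    frontier {x | f x ≤ r} = {x | f x = r} ∧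
    ∀ F : Set E, (IsFace {x | f x ≤ r} F ∧ F ≠ {x | f x ≤ r}) ↔
      ∃ M : Set E, IsRealFnFace f M ∧ F = M ∩ {x | f x = r} := by
  obtain ⟨x₀, hx₀⟩ : ∃ x, f x < r := by simpa using hr
  refine ⟨hconv.frontier_sublevel hcont hx₀, fun F => ⟨fun ⟨hF, hne⟩ => ?_, ?_⟩⟩
  · refine hF.exists_isRealFnFace_of_subset_level hconv fun x hx => ?_
    refine (hF.1 hx).eq_of_not_lt fun hlt => hne (hF.eq_of_mem_interior hx ?_)
    rwa [hconv.interior_sublevel hcont hx₀]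
  · rintro ⟨M, hM, rfl⟩
    refine ⟨hM.isFace_inter_level r, fun h => hx₀.ne ?_⟩
    have hmem : x₀ ∈ M ∩ {x | f x = r} := h ▸ hx₀.le
    exact hmem.2
end
end

section
/- Let f : H → ℝ ∪ {+∞} be a proper lower-semicontinuous convex function and 𝒜 : E → H a linear transformation between finite-dimensional real inner product spaces. Let x̄ ∈ E and let v ∈ ∂f(𝒜x̄). Then ∂(f ∘ 𝒜)*(𝒜*v) = 𝒜⁻¹(∂f*(v)), where 𝒜* is the adjoint of 𝒜. -/
noncomputable section

open Set
open scoped RealInnerProductSpace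

/-- The epigraph of `f : E → ℝ ∪ {+∞}`. -/
def Epi {E : Type*} (f : E → EReal) : Set (E × ℝ) := {p | f p.1 ≤ (p.2 : EReal)}

/-- The convex subdifferential of `f` at `x`. -/
def Subdiff {E : Type*} [NormedAddCommGroup E] [InnerProductSpace ℝ E]
    (f : E → EReal) (x : E) : Set E :=
  {v | ∀ y, f x + ((⟪v, y - x⟫ : ℝ) : EReal) ≤ f y}

/-- The Fenchel conjugate of `f`. -/
def Conj {E : Type*} [NormedAddCommGroup E] [InnerProductSpace ℝ E]
    (f : E → EReal) (u : E) : EReal :=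
  ⨆ x, (((⟪u, x⟫ : ℝ) : EReal) - f x)

/-- A real number bounds the conjugate iff it bounds the corresponding affine functional
over the epigraph. -/
theorem conj_le_coe_iff {E : Type*} [NormedAddCommGroup E] [InnerProductSpace ℝ E]
    {g : E → EReal} {w : E} {b : ℝ} :
    Conj g w ≤ (b : EReal) ↔ ∀ y : E, ∀ r : ℝ, (y, r) ∈ Epi g → ⟪w, y⟫ - r ≤ b := by
  simp only [Conj, iSup_le_iff, Epi, mem_ofPred_eq]
  refine forall_congr' fun y => ?_
  induction g y with
  | bot =>
    refine iff_of_false (by simp) fun h => ?_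
    have := h (⟪w, y⟫ - b - 1) bot_le
    linarith
  | coe a =>
    norm_cast
    exact ⟨fun h r hr => by linarith, fun h => h a le_rfl⟩
  | top => simp

theorem isClosed_epi {E : Type*} [TopologicalSpace E] {g : E → EReal}
    (hlsc : LowerSemicontinuous g) : IsClosed (Epi g) :=
  hlsc.isClosed_epigraph.preimage
    (continuous_fst.prodMk (continuous_coe_real_ereal.comp continuous_snd))

/-- The conjugate is attained at a point where the function is finite and has the given
subgradient. -/
theorem conj_eq_of_mem_subdiff {E : Type*} [NormedAddCommGroup E] [InnerProductSpace ℝ E]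
    {g : E → EReal} {x u : E} {a : ℝ} (ha : g x = a) (hu : u ∈ Subdiff g x) :
    Conj g u = ((⟪u, x⟫ - a : ℝ) : EReal) := by
  apply le_antisymm
  · refine conj_le_coe_iff.2 fun y r hr => ?_
    have h : g x + ((⟪u, y - x⟫ : ℝ) : EReal) ≤ r := (hu y).trans hr
    rw [ha, inner_sub_right] at h
    norm_cast at h
    linarith
  · have h := le_iSup (fun y => ((⟪u, y⟫ : ℝ) : EReal) - g y) x
    simp only [ha] at h
    exact_mod_cast h

/-- Fenchel's equality characterizes the subgradients of the conjugate of a closed convex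
function at a point where the conjugate is finite. -/
theorem mem_subdiff_conj_iff {E : Type*} [NormedAddCommGroup E] [InnerProductSpace ℝ E]
    [CompleteSpace E] {g : E → EReal} (hlsc : LowerSemicontinuous g)
    (hconv : Convex ℝ (Epi g)) {u x : E} {c : ℝ} (hc : Conj g u = c) :
    x ∈ Subdiff (Conj g) u ↔ g x ≤ ((⟪u, x⟫ - c : ℝ) : EReal) := by
  constructor
  · intro hx
    by_contra hlt
    have hbound := conj_le_coe_iff.1 hc.le
    obtain ⟨φ, s, hφ, hs⟩ := geometric_hahn_banach_closed_point hconv (isClosed_epi hlsc)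
      (x := (x, ⟪u, x⟫ - c)) hlt
    let p := (InnerProductSpace.toDual ℝ E).symm (φ.comp (.inl ℝ E ℝ))
    let q := φ (0, 1)
    have hφ_eq (y : E) (r : ℝ) : φ (y, r) = ⟪p, y⟫ + q * r := by
      have h : (y, r) = (y, (0 : ℝ)) + r • ((0 : E), (1 : ℝ)) := by simp
      rw [h, map_add, map_smul]
      simp [p, q, mul_comm]
    have hne : ∃ y r, (y, r) ∈ Epi g := by
      by_contra! hempty
      have h := conj_le_coe_iff (w := u) (b := c - 1) |>.2 fun y r hr => (hempty y r hr).elim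
      rw [hc] at h
      norm_cast at h
      linarith
    obtain ⟨y₀, r₀, h₀⟩ := hne
    have hq : q ≤ 0 := by
      by_contra! hq
      have hmem : (y₀, max r₀ ((s - ⟪p, y₀⟫) / q)) ∈ Epi g :=
        le_trans (show g y₀ ≤ r₀ from h₀) (by exact_mod_cast le_max_left _ _)
      have h := hφ _ hmem
      rw [hφ_eq] at h
      have h' := (div_le_iff₀' hq).1 (le_max_right r₀ ((s - ⟪p, y₀⟫) / q))
      linarith
    have hq' : 0 < 1 - q := by linarith
    have hw : Conj g ((1 - q)⁻¹ • (u + p)) ≤ (((1 - q)⁻¹ * (c + s) : ℝ) : EReal) := by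
      refine conj_le_coe_iff.2 fun y r hr => ?_
      have h₁ := hbound y r hr
      have h₂ := hφ _ hr
      rw [hφ_eq] at h₂
      rw [real_inner_smul_left, inner_add_left]
      refine le_of_mul_le_mul_left ?_ hq'
      have e₁ := mul_inv_cancel_left₀ hq'.ne' (⟪u, y⟫ + ⟪p, y⟫)
      have e₂ := mul_inv_cancel_left₀ hq'.ne' (c + s)
      linarith
    have h := (hx _).trans hw
    rw [hc] at h
    norm_cast at h
    rw [hφ_eq] at hs
    rw [inner_sub_right, real_inner_smul_right, inner_add_right, real_inner_comm u x,
      real_inner_comm p x] at h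
    have h' := mul_le_mul_of_nonneg_left h hq'.le
    have e₁ := mul_inv_cancel_left₀ hq'.ne' (⟪u, x⟫ + ⟪p, x⟫)
    have e₂ := mul_inv_cancel_left₀ hq'.ne' (c + s)
    linarith
  · intro hx w
    refine le_trans ?_ (le_iSup (fun y => ((⟪w, y⟫ : ℝ) : EReal) - g y) x)
    refine le_trans ?_ (EReal.sub_le_sub le_rfl hx)
    rw [hc, inner_sub_right, real_inner_comm w x, real_inner_comm u x]
    norm_cast
    linarith

/-- **Chain rule for conjugates.**  If `v ∈ ∂f(𝒜 xbar)`, then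
`∂(f ∘ 𝒜)*(𝒜* v) = 𝒜⁻¹(∂f*(v))`. -/
theorem stmt8 {E H : Type*} [NormedAddCommGroup E] [InnerProductSpace ℝ E]
    [FiniteDimensional ℝ E] [NormedAddCommGroup H] [InnerProductSpace ℝ H]
    [FiniteDimensional ℝ H] (f : H → EReal)
    (hproper : (∀ y, f y ≠ ⊥) ∧ ∃ y, f y ≠ ⊤)
    (hlsc : LowerSemicontinuous f) (hconv : Convex ℝ (Epi f))
    (A : E →ₗ[ℝ] H) (xbar : E) (v : H) (hv : v ∈ Subdiff f (A xbar)) :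
    Subdiff (Conj fun x => f (A x)) (LinearMap.adjoint A v) =
      A ⁻¹' Subdiff (Conj f) v := by
  have : CompleteSpace H := FiniteDimensional.complete ℝ H
  have : CompleteSpace E := FiniteDimensional.complete ℝ E
  have htop : f (A xbar) ≠ ⊤ := by
    intro h
    obtain ⟨y, hy⟩ := hproper.2
    have := hv y
    simp [h, hy] at this
  obtain ⟨a, ha⟩ : ∃ a : ℝ, f (A xbar) = a :=
    ⟨_, (EReal.coe_toReal htop (hproper.1 _)).symm⟩
  have hv' : LinearMap.adjoint A v ∈ Subdiff (fun x => f (A x)) xbar := fun y => by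
    simpa only [LinearMap.adjoint_inner_left, map_sub] using hv (A y)
  have hlsc' : LowerSemicontinuous fun x => f (A x) :=
    hlsc.comp A.continuous_of_finiteDimensional
  have hconv' : Convex ℝ (Epi fun x => f (A x)) :=
    hconv.linear_preimage (A.prodMap LinearMap.id)
  have hc := conj_eq_of_mem_subdiff ha hv
  have hc' := conj_eq_of_mem_subdiff (g := fun x => f (A x)) ha hv'
  ext x
  rw [mem_preimage, mem_subdiff_conj_iff hlsc hconv hc, mem_subdiff_conj_iff hlsc' hconv' hc',
    LinearMap.adjoint_inner_left, LinearMap.adjoint_inner_left]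
end
end
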